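/- arXiv:2012.15384 — 2 statements merged into one kernel-verified Lean document; each statement's English description precedes it below -/
import Mathlib

section
/- For each prime power q with q odd, the character of the Gelfand model of G = PGL₂(𝔽_q), i.e. the sum of all irreducible complex characters of G each taken once, has degree equal to the number of involutions in G (elements g with g² = 1, including the identity). -/
open CategoryTheory

namespace Representation

section CompleteReducibility

variable {G : Type*} [Group G] {V : Type*} [AddCommGroup V] [Module ℂ V]
  (ρ : Representation ℂ G V)

theorem subrepresentation_eq_bot_of_subsingleton (U : Subrepresentation ρ)
    [hU : Subsingleton U.toSubmodule] : U = ⊥ :=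
  Subrepresentation.toSubmodule_injective (Submodule.eq_bot_of_subsingleton)

variable [FiniteDimensional ℂ V]

theorem character_eq_add_of_isCompl {U U' : Subrepresentation ρ} (h : IsCompl U U') (g : G) :
    ρ.character g = U.toRepresentation.character g + U'.toRepresentation.character g := by
  have hc : IsCompl U.toSubmodule U'.toSubmodule := by
    constructor
    · rw [disjoint_iff, ← Subrepresentation.toSubmodule_inf, h.inf_eq_bot]; rfl
    · rw [codisjoint_iff, ← Subrepresentation.toSubmodule_sup, h.sup_eq_top]; rfl
  have hint : DirectSum.IsInternal fun b : Bool => bif b then U.toSubmodule else U'.toSubmodule :=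
    (DirectSum.isInternal_submodule_iff_isCompl _ (i := true) (j := false) (by decide)
      (by ext b; cases b <;> simp)).2 hc
  have hf : ∀ b : Bool, Set.MapsTo (ρ g)
      ((bif b then U.toSubmodule else U'.toSubmodule : Submodule ℂ V) : Set V)
      ((bif b then U.toSubmodule else U'.toSubmodule : Submodule ℂ V) : Set V) := by
    rintro (_ | _)
    · exact U'.apply_mem_toSubmodule g
    · exact U.apply_mem_toSubmodule g
  have := LinearMap.trace_eq_sum_trace_restrict hint hf
  rw [Fintype.sum_bool] at this
  exact this

theorem subsingleton_of_finrank_intertwiningMap_eq_zero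
    (h : Module.finrank ℂ (IntertwiningMap ρ ρ) = 0) : Subsingleton V := by
  have hs : Subsingleton (IntertwiningMap ρ ρ) := Module.finrank_zero_iff.1 h
  refine ⟨fun x y => ?_⟩
  have hx (z : V) : z = 0 :=
    DFunLike.congr_fun (hs.elim (IntertwiningMap.id ρ) 0) z
  rw [hx x, hx y]

variable [Fintype G]

theorem isIrreducible_of_finrank_eq_one (h : Module.finrank ℂ (IntertwiningMap ρ ρ) = 1) :
    IsIrreducible ρ := by
  have : Invertible (Nat.card G : ℂ) := invertibleOfNonzero (NeZero.ne _)
  have hn : Nontrivial (Subrepresentation ρ) := by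
    by_contra hn
    rw [not_nontrivial_iff_subsingleton] at hn
    have hbt := congrArg Subrepresentation.toSubmodule (hn.elim ⊤ ⊥)
    have hV : Subsingleton V := by
      rw [← Submodule.subsingleton_iff ℂ]
      exact subsingleton_of_bot_eq_top hbt.symm
    have : Subsingleton (IntertwiningMap ρ ρ) :=
      ⟨fun f g => DFunLike.ext _ _ fun _ => Subsingleton.elim _ _⟩
    rw [Module.finrank_zero_of_subsingleton] at h
    exact zero_ne_one h
  refine { eq_bot_or_eq_top := fun U => ?_ }
  obtain ⟨U', hU⟩ := exists_isCompl U
  set σ := U.toRepresentation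
  set τ := U'.toRepresentation
  have hsum : Module.finrank ℂ (IntertwiningMap σ σ) + Module.finrank ℂ (IntertwiningMap σ τ) +
      Module.finrank ℂ (IntertwiningMap τ σ) + Module.finrank ℂ (IntertwiningMap τ τ) = 1 := by
    rw [← h]
    apply Nat.cast_injective (R := ℂ)
    push_cast
    simp only [← card_inv_mul_sum_char_mul_char_eq_finrank, ← mul_add, ← Finset.sum_add_distrib,
      character_eq_add_of_isCompl ρ hU]
    congr 1
    refine Finset.sum_congr rfl fun g _ => ?_
    ring
  have : Module.finrank ℂ (IntertwiningMap σ σ) = 0 ∨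
    Module.finrank ℂ (IntertwiningMap τ τ) = 0 := by lia
  rcases this with h0 | h0
  · have := subsingleton_of_finrank_intertwiningMap_eq_zero _ h0
    exact .inl (subrepresentation_eq_bot_of_subsingleton ρ U)
  · have := subsingleton_of_finrank_intertwiningMap_eq_zero _ h0
    have hb := subrepresentation_eq_bot_of_subsingleton ρ U'
    exact .inr (by simpa [hb] using hU.sup_eq_top)

end CompleteReducibility

/-- The right regular representation on functions. -/
def rightRegular (G : Type*) [Group G] : Representation ℂ G (G → ℂ) where
  toFun g := LinearMap.funLeft ℂ ℂ (· * g)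
  map_one' := by ext; simp [LinearMap.funLeft_apply]
  map_mul' g h := by ext; simp [LinearMap.funLeft_apply, mul_assoc]

theorem character_rightRegular {G : Type*} [Group G] [Fintype G] [DecidableEq G] (g : G) :
    (rightRegular G).character g = if g = 1 then (Nat.card G : ℂ) else 0 := by
  classical
  rw [character, LinearMap.trace_eq_matrix_trace ℂ (Pi.basisFun ℂ G), Matrix.trace]
  simp only [Matrix.diag_apply, LinearMap.toMatrix_apply, rightRegular, Pi.basisFun_apply,
    Pi.basisFun_repr, MonoidHom.coe_mk, OneHom.coe_mk, LinearMap.funLeft_apply, Pi.single_apply,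
    mul_eq_left]
  split_ifs <;> simp

end Representation

namespace FDRep

variable {G : Type} [Group G] [Fintype G]

theorem isIrreducible_of_simple (V : FDRep ℂ G) [Simple V] :
    Representation.IsIrreducible V.ρ := by
  classical
  have : Invertible (Nat.card G : ℂ) := invertibleOfNonzero (NeZero.ne _)
  apply Representation.isIrreducible_of_finrank_eq_one
  apply Nat.cast_injective (R := ℂ)
  rw [← Representation.card_inv_mul_sum_char_mul_char_eq_finrank]
  have := char_orthonormal V V
  rw [if_pos ⟨Iso.refl V⟩] at this
  rw [Nat.cast_one]
  exact this

theorem simple_of_isIrreducible {V : Type} [AddCommGroup V] [Module ℂ V] [FiniteDimensional ℂ V]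
    (ρ : Representation ℂ G V) [ρ.IsIrreducible] : Simple (FDRep.of ρ) := by
  classical
  have : Invertible (Nat.card G : ℂ) := invertibleOfNonzero (NeZero.ne _)
  rw [simple_iff_char_is_norm_one]
  have := Representation.char_orthonormal ρ ρ
  rw [if_pos ⟨Representation.Equiv.refl ρ⟩, inv_mul_eq_one₀ (NeZero.ne _)] at this
  exact this.symm

/-- A character is the combination of irreducible characters prescribed by its inner products. -/
theorem character_eq_sum_of_complete {ι : Type*} [Fintype ι] (V : ι → FDRep ℂ G)
    (hsimple : ∀ i, Simple (V i))
    (hcomplete : ∀ W : FDRep ℂ G, Simple W → ∃! i, Nonempty (V i ≅ W))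
    {W : Type} [AddCommGroup W] [Module ℂ W] [FiniteDimensional ℂ W] (ρ : Representation ℂ G W)
    (g : G) :
    ρ.character g = ∑ i, ((Nat.card G : ℂ)⁻¹ * ∑ h, ρ.character h * (V i).character h⁻¹) *
      (V i).character g := by
  classical
  have : Invertible (Nat.card G : ℂ) := invertibleOfNonzero (NeZero.ne _)
  induction hn : Module.finrank ℂ W using Nat.strong_induction_on generalizing W with
  | _ n ih =>
    by_cases hirr : ρ.IsIrreducible
    · have := simple_of_isIrreducible ρ
      obtain ⟨i, ⟨φ⟩, hi⟩ := hcomplete _ this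
      have hchar : ρ.character = (V i).character := (char_iso φ).symm
      have horth (j : ι) : (Nat.card G : ℂ)⁻¹ * ∑ h, ρ.character h * (V j).character h⁻¹ =
          if j = i then 1 else 0 := by
        rw [hchar, char_orthonormal]
        refine if_congr ⟨?_, ?_⟩ rfl rfl
        · rintro ⟨ψ⟩
          exact hi j ⟨ψ.symm ≪≫ φ⟩
        · rintro rfl
          exact ⟨Iso.refl _⟩
      simp_rw [horth]
      simp [hchar]
    · by_cases hW : Subsingleton W
      · have (h : G) : ρ.character h = 0 := by
          rw [Representation.character, Subsingleton.elim (ρ h) 0, map_zero]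
        simp [this]
      have hsplit : ∃ U : Subrepresentation ρ, U ≠ ⊥ ∧ U ≠ ⊤ := by
        by_contra! hU
        refine hirr { exists_pair_ne := ⟨⊥, ⊤, fun h => hW ?_⟩, eq_bot_or_eq_top := fun U => ?_ }
        · rw [← Submodule.subsingleton_iff ℂ]
          exact subsingleton_of_bot_eq_top (congrArg Subrepresentation.toSubmodule h)
        · exact or_iff_not_imp_left.2 (hU U)
      obtain ⟨U, hbot, htop⟩ := hsplit
      obtain ⟨U', hU⟩ := exists_isCompl U
      have hlt {U : Subrepresentation ρ} (h : U ≠ ⊤) : Module.finrank ℂ U.toSubmodule < n :=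
        hn ▸ Submodule.finrank_lt fun h' => h (Subrepresentation.toSubmodule_injective h')
      have htop' : U' ≠ ⊤ := by
        rintro rfl
        exact hbot (by simpa using hU.inf_eq_bot)
      simp only [Representation.character_eq_add_of_isCompl ρ hU, add_mul, mul_add,
        Finset.sum_add_distrib]
      rw [ih _ (hlt htop) U.toRepresentation rfl, ih _ (hlt htop') U'.toRepresentation rfl]

theorem sum_finrank_mul_character [DecidableEq G] {ι : Type*} [Fintype ι] (V : ι → FDRep ℂ G)
    (hsimple : ∀ i, Simple (V i))
    (hcomplete : ∀ W : FDRep ℂ G, Simple W → ∃! i, Nonempty (V i ≅ W)) (g : G) :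
    ∑ i, (Module.finrank ℂ (V i) : ℂ) * (V i).character g =
      if g = 1 then (Nat.card G : ℂ) else 0 := by
  rw [← Representation.character_rightRegular,
    character_eq_sum_of_complete V hsimple hcomplete (Representation.rightRegular G) g]
  refine Finset.sum_congr rfl fun i _ => ?_
  simp [Representation.character_rightRegular]

end FDRep

namespace Representation

open Matrix.GeneralLinearGroup

section Whittaker

variable {F : Type*} [Field F] {V : Type*} [AddCommGroup V] [Module ℂ V]

theorem IsIrreducible.span_orbit_eq_top {G : Type*} [Group G] (σ : Representation ℂ G V)
    [hσ : σ.IsIrreducible] {v : V} (hv : v ≠ 0) :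
    Submodule.span ℂ (Set.range fun g => σ g v) = ⊤ := by
  let U : Subrepresentation σ :=
    { toSubmodule := Submodule.span ℂ (Set.range fun g => σ g v)
      apply_mem_toSubmodule := by
        intro g w hw
        induction hw using Submodule.span_induction with
        | mem x hx =>
          obtain ⟨h, rfl⟩ := hx
          exact Submodule.subset_span ⟨g * h, by simp⟩
        | zero => simp
        | add x y _ _ hx hy => rw [map_add]; exact add_mem hx hy
        | smul c x _ hx => rw [map_smul]; exact Submodule.smul_mem _ _ hx }
  have hvU : v ∈ U.toSubmodule := Submodule.subset_span ⟨1, by simp⟩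
  rcases hσ.eq_bot_or_eq_top U with h | h
  · rw [h] at hvU
    exact absurd ((Submodule.mem_bot ℂ).1 hvU) hv
  · exact congrArg Subrepresentation.toSubmodule h

/-- The involution `w gᵀ w⁻¹` of `GL₂`, which fixes the upper unipotent matrices. -/
def antiTranspose (g : GL (Fin 2) F) : GL (Fin 2) F :=
  mkOfDetNeZero !![g.val 1 1, g.val 0 1; g.val 1 0, g.val 0 0] (by
    have := g.det.ne_zero
    rw [Matrix.GeneralLinearGroup.val_det_apply, Matrix.det_fin_two] at this
    rw [Matrix.det_fin_two_of, mul_comm]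
    exact this)

@[simp]
theorem antiTranspose_mul (g h : GL (Fin 2) F) :
    antiTranspose (g * h) = antiTranspose h * antiTranspose g := by
  ext i j
  fin_cases i <;> fin_cases j <;>
    simp [antiTranspose, mkOfDetNeZero, Matrix.mul_apply, Fin.sum_univ_two] <;> ring

@[simp]
theorem antiTranspose_upperRightHom (x : F) :
    antiTranspose (upperRightHom x) = upperRightHom x := by
  ext i j
  fin_cases i <;> fin_cases j <;> simp [antiTranspose, mkOfDetNeZero]

theorem antiTranspose_eq_conj {g : GL (Fin 2) F} (hg : g.val 1 0 ≠ 0) :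
    ∃ t : F, antiTranspose g = upperRightHom t * g * upperRightHom (-t) := by
  refine ⟨(g.val 1 1 - g.val 0 0) / g.val 1 0, ?_⟩
  ext i j
  fin_cases i <;> fin_cases j <;>
    simp [antiTranspose, mkOfDetNeZero, Matrix.mul_apply, Matrix.vecMul, dotProduct,
      Fin.sum_univ_two] <;>
    field_simp <;> ring

theorem mul_upperRightHom_of_lower_eq_zero {g : GL (Fin 2) F} (hg : g.val 1 0 = 0)
    (hd : g.val 1 1 ≠ 0) (x : F) :
    g * upperRightHom x = upperRightHom (g.val 0 0 * x / g.val 1 1) * g := by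
  ext i j
  fin_cases i <;> fin_cases j <;>
    simp [Matrix.mul_apply, Fin.sum_univ_two, hg]
  field_simp
  ring

variable [Fintype F] (σ : Representation ℂ (GL (Fin 2) F) V) (ψ : AddChar F ℂ)

/-- The projection onto the vectors on which the upper unipotent matrices act through `ψ`. -/
noncomputable def whittakerProj : Module.End ℂ V :=
  (Fintype.card F : ℂ)⁻¹ • ∑ x, ψ (-x) • σ (upperRightHom x)

@[simp]
theorem whittakerProj_mul_upperRightHom (y : F) :
    whittakerProj σ ψ * σ (upperRightHom y) = ψ y • whittakerProj σ ψ := by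
  rw [whittakerProj, smul_mul_assoc, smul_comm (ψ y), Finset.sum_mul,
    Finset.smul_sum (r := ψ y)]
  congr 1
  refine Fintype.sum_equiv (Equiv.addRight y) _ _ fun x => ?_
  rw [smul_mul_assoc, smul_smul, ← map_mul, ← AddChar.map_add_eq_mul, Equiv.coe_addRight,
    ← AddChar.map_add_eq_mul]
  congr 2
  ring

@[simp]
theorem upperRightHom_mul_whittakerProj (y : F) :
    σ (upperRightHom y) * whittakerProj σ ψ = ψ y • whittakerProj σ ψ := by
  rw [whittakerProj, mul_smul_comm, smul_comm (ψ y), Finset.mul_sum,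
    Finset.smul_sum (r := ψ y)]
  congr 1
  refine Fintype.sum_equiv (Equiv.addLeft y) _ _ fun x => ?_
  rw [mul_smul_comm, smul_smul, ← map_mul, ← AddChar.map_add_eq_mul, Equiv.coe_addLeft,
    ← AddChar.map_add_eq_mul]
  congr 2
  ring

theorem whittakerProj_isIdempotentElem : IsIdempotentElem (whittakerProj σ ψ) := by
  unfold IsIdempotentElem
  conv_lhs => enter [2]; rw [whittakerProj]
  rw [mul_smul_comm, Finset.mul_sum]
  simp_rw [mul_smul_comm, whittakerProj_mul_upperRightHom, smul_smul, ← AddChar.map_add_eq_mul]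
  have : (Fintype.card F : ℂ) ≠ 0 := Nat.cast_ne_zero.2 Fintype.card_ne_zero
  simp [← Nat.cast_smul_eq_nsmul ℂ, smul_smul, this]

/-- The Hecke operator attached to the double coset of `g`. -/
noncomputable def whittakerHecke (g : GL (Fin 2) F) : Module.End ℂ V :=
  whittakerProj σ ψ * σ g * whittakerProj σ ψ

theorem whittakerHecke_upperRightHom_mul (x : F) (g : GL (Fin 2) F) :
    whittakerHecke σ ψ (upperRightHom x * g) = ψ x • whittakerHecke σ ψ g := by
  rw [whittakerHecke, map_mul, ← mul_assoc, whittakerProj_mul_upperRightHom, smul_mul_assoc,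
    smul_mul_assoc, whittakerHecke]

theorem whittakerHecke_mul_upperRightHom (g : GL (Fin 2) F) (x : F) :
    whittakerHecke σ ψ (g * upperRightHom x) = ψ x • whittakerHecke σ ψ g := by
  rw [whittakerHecke, map_mul, mul_assoc, mul_assoc, upperRightHom_mul_whittakerProj,
    mul_smul_comm, mul_smul_comm, ← mul_assoc, whittakerHecke]

theorem whittakerHecke_antiTranspose (hψ : ψ.IsPrimitive) (g : GL (Fin 2) F) :
    whittakerHecke σ ψ (antiTranspose g) = whittakerHecke σ ψ g := by
  have hzero : ∀ {g : GL (Fin 2) F}, g.val 1 0 = 0 → g.val 0 0 ≠ g.val 1 1 →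
      whittakerHecke σ ψ g = 0 := by
    intro g hg hne
    have hdet := g.det.ne_zero
    rw [Matrix.GeneralLinearGroup.val_det_apply, Matrix.det_fin_two, hg, mul_zero, sub_zero]
      at hdet
    have hd := right_ne_zero_of_mul hdet
    have hshift : AddChar.mulShift ψ (g.val 0 0 / g.val 1 1 - 1) ≠ 1 :=
      hψ (sub_ne_zero.2 (by rwa [ne_eq, div_eq_one_iff_eq hd]))
    obtain ⟨x, hx⟩ := AddChar.ne_one_iff.1 hshift
    have h := whittakerHecke_mul_upperRightHom σ ψ g x
    rw [mul_upperRightHom_of_lower_eq_zero hg hd, whittakerHecke_upperRightHom_mul,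
      ← sub_eq_zero, ← sub_smul] at h
    refine (smul_eq_zero.1 h).resolve_left fun h0 => hx ?_
    rw [AddChar.mulShift_apply, sub_mul, one_mul, div_mul_eq_mul_div, AddChar.map_sub_eq_div,
      sub_eq_zero.1 h0, div_self (ψ.val_isUnit x).ne_zero]
  by_cases hg : g.val 1 0 = 0
  · by_cases hne : g.val 0 0 = g.val 1 1
    · congr 1
      ext i j
      fin_cases i <;> fin_cases j <;> simp [antiTranspose, mkOfDetNeZero, hne]
    · rw [hzero hg hne, hzero]
      · simpa [antiTranspose, mkOfDetNeZero] using hg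
      · simpa [antiTranspose, mkOfDetNeZero] using Ne.symm hne
  · obtain ⟨t, ht⟩ := antiTranspose_eq_conj hg
    rw [ht, whittakerHecke_mul_upperRightHom, whittakerHecke_upperRightHom_mul, smul_smul,
      ← AddChar.map_add_eq_mul, neg_add_cancel, AddChar.map_zero_eq_one, one_smul]

theorem whittakerHecke_mul (g h : GL (Fin 2) F) :
    whittakerHecke σ ψ g * whittakerHecke σ ψ h = (Fintype.card F : ℂ)⁻¹ •
      ∑ x, ψ (-x) • whittakerHecke σ ψ (g * upperRightHom x * h) := by
  have : whittakerHecke σ ψ g * whittakerHecke σ ψ h =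
      whittakerProj σ ψ * σ g * (whittakerProj σ ψ * whittakerProj σ ψ) * σ h *
        whittakerProj σ ψ := by
    simp only [whittakerHecke, mul_assoc]
  rw [this, whittakerProj_isIdempotentElem]
  conv_lhs => enter [1, 1, 2]; rw [whittakerProj]
  simp only [mul_smul_comm, smul_mul_assoc, Finset.mul_sum, Finset.sum_mul, whittakerHecke,
    map_mul, mul_assoc]

theorem whittakerHecke_comm (hψ : ψ.IsPrimitive) (g h : GL (Fin 2) F) :
    whittakerHecke σ ψ g * whittakerHecke σ ψ h = whittakerHecke σ ψ h * whittakerHecke σ ψ g := by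
  rw [whittakerHecke_mul, ← whittakerHecke_antiTranspose σ ψ hψ g,
    ← whittakerHecke_antiTranspose σ ψ hψ h, whittakerHecke_mul]
  congr 1
  refine Finset.sum_congr rfl fun x _ => ?_
  rw [← whittakerHecke_antiTranspose σ ψ hψ]
  simp [mul_assoc, -upperRightHom_apply]

theorem whittakerProj_mem_span [σ.IsIrreducible] {v : V} (hv : v ≠ 0)
    (hfix : whittakerProj σ ψ v = v) (w : V) :
    whittakerProj σ ψ w ∈ Submodule.span ℂ (Set.range fun g => whittakerHecke σ ψ g v) := by
  have hw : w ∈ Submodule.span ℂ (Set.range fun g => σ g v) := by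
    rw [IsIrreducible.span_orbit_eq_top σ hv]
    trivial
  have := Submodule.mem_map_of_mem (f := whittakerProj σ ψ) hw
  rw [Submodule.map_span, ← Set.range_comp] at this
  convert this using 4 with g
  simp [whittakerHecke, hfix]

/-- Uniqueness of Whittaker models. -/
theorem finrank_range_whittakerProj_le_one [FiniteDimensional ℂ V] [σ.IsIrreducible]
    (hψ : ψ.IsPrimitive) : Module.finrank ℂ (LinearMap.range (whittakerProj σ ψ)) ≤ 1 := by
  set P := whittakerProj σ ψ with hP
  have hPP (w : V) : P (P w) = P w :=
    LinearMap.congr_fun (whittakerProj_isIdempotentElem σ ψ) w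
  by_cases hbot : LinearMap.range P = ⊥
  · rw [hbot, finrank_bot]
    exact zero_le_one
  have hnt : Nontrivial (LinearMap.range P) := Submodule.nontrivial_iff_ne_bot.2 hbot
  have hscalar (g : GL (Fin 2) F) : ∃ c : ℂ, ∀ w, whittakerHecke σ ψ g (P w) = c • P w := by
    have hmaps : ∀ v ∈ LinearMap.range P, whittakerHecke σ ψ g v ∈ LinearMap.range P :=
      fun v _ => ⟨σ g (P v), by simp [whittakerHecke, hP]⟩
    obtain ⟨c, hc⟩ := Module.End.exists_eigenvalue ((whittakerHecke σ ψ g).restrict hmaps)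
    obtain ⟨⟨v, v', rfl⟩, hv⟩ := hc.exists_hasEigenvector
    have hv0 : P v' ≠ 0 := fun h => hv.2 (Subtype.ext h)
    have hev : whittakerHecke σ ψ g (P v') = c • P v' := congrArg Subtype.val hv.apply_eq_smul
    refine ⟨c, fun w => ?_⟩
    have hw : P w ∈ _ := whittakerProj_mem_span σ ψ hv0 (hPP v') w
    generalize P w = z at hw ⊢
    induction hw using Submodule.span_induction with
    | mem x hx =>
      obtain ⟨h, rfl⟩ := hx
      have := LinearMap.congr_fun (whittakerHecke_comm σ ψ hψ g h) (P v')
      simp only [Module.End.mul_apply, hev, map_smul] at this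
      exact this
    | zero => simp
    | add x y _ _ hx hy => rw [map_add, hx, hy, smul_add]
    | smul a x _ hx => rw [map_smul, hx, smul_comm]
  obtain ⟨⟨v, v', rfl⟩, hv⟩ := exists_ne (0 : LinearMap.range P)
  have hv0 : P v' ≠ 0 := fun h => hv (Subtype.ext h)
  refine finrank_le_one ⟨P v', v', rfl⟩ ?_
  rintro ⟨_, w, rfl⟩
  have hspan : P w ∈ Submodule.span ℂ {P v'} := by
    refine Submodule.span_le.2 ?_ (whittakerProj_mem_span σ ψ hv0 (hPP v') w)
    rintro _ ⟨g, rfl⟩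
    obtain ⟨c, hc⟩ := hscalar g
    exact Submodule.mem_span_singleton.2 ⟨c, (hc v').symm⟩
  obtain ⟨c, hc⟩ := Submodule.mem_span_singleton.1 hspan
  exact ⟨c, Subtype.ext hc⟩

theorem upperRightHom_eq_one_of_whittakerProj_eq_zero (hψ : ψ.IsPrimitive)
    (h : whittakerProj σ ψ = 0) (y : F) : σ (upperRightHom y) = 1 := by
  classical
  have hq : (Fintype.card F : ℂ) ≠ 0 := Nat.cast_ne_zero.2 Fintype.card_ne_zero
  have hsum : ∑ x, ψ (-x) • σ (upperRightHom x) = 0 :=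
    (smul_eq_zero.1 h).resolve_left (inv_ne_zero hq)
  have hshift (a : F) (ha : a ≠ 0) : ∑ x, ψ (-(a * x)) • σ (upperRightHom x) = 0 := by
    let D : GL (Fin 2) F := mkOfDetNeZero !![a, 0; 0, 1] (by simpa using ha)
    have hD (x : F) : D * upperRightHom x = upperRightHom (a * x) * D := by
      ext i j
      fin_cases i <;> fin_cases j <;>
        simp [D, mkOfDetNeZero, Matrix.mul_apply, Fin.sum_univ_two]
    have h0 : σ D * ∑ x, ψ (-(a * x)) • σ (upperRightHom x) = 0 := by
      rw [← zero_mul (σ D), ← hsum, Finset.mul_sum, Finset.sum_mul]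
      refine Fintype.sum_equiv (Equiv.mulLeft₀ a ha) _ _ fun x => ?_
      rw [mul_smul_comm, ← map_mul, hD, map_mul, smul_mul_assoc, Equiv.mulLeft₀_apply]
    calc _ = σ D⁻¹ * (σ D * ∑ x, ψ (-(a * x)) • σ (upperRightHom x)) := by
          rw [← mul_assoc, ← map_mul, inv_mul_cancel, map_one, one_mul]
      _ = 0 := by rw [h0, mul_zero]
  have hconst (y : F) :
      (Fintype.card F : ℂ) • σ (upperRightHom y) = ∑ x, σ (upperRightHom x) := by
    calc (Fintype.card F : ℂ) • σ (upperRightHom y)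
        = ∑ x, (∑ a, ψ (a * (y - x))) • σ (upperRightHom x) := by
          simp_rw [AddChar.sum_mulShift _ hψ, sub_eq_zero, Nat.cast_ite, ite_smul]
          simp
      _ = ∑ a, ψ (a * y) • ∑ x, ψ (-(a * x)) • σ (upperRightHom x) := by
          simp_rw [Finset.sum_smul, Finset.smul_sum, smul_smul, ← AddChar.map_add_eq_mul]
          rw [Finset.sum_comm]
          simp_rw [mul_sub, sub_eq_add_neg]
      _ = ∑ x, σ (upperRightHom x) := by
          rw [Finset.sum_eq_single 0 (fun a _ ha => by rw [hshift a ha, smul_zero]) (by simp)]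
          simp [-upperRightHom_apply]
  have := (hconst y).trans (hconst 0).symm
  rw [AddChar.map_zero_eq_one, map_one] at this
  exact smul_right_injective _ hq this

end Whittaker

section Unipotent

variable {F : Type*} [Field F]

theorem map_eq_one_of_det_eq_one {M : Type*} [Monoid M] (σ : GL (Fin 2) F →* M)
    (h : ∀ x, σ (upperRightHom x) = 1) {g : GL (Fin 2) F} (hg : g.val.det = 1) : σ g = 1 := by
  let w : GL (Fin 2) F := mkOfDetNeZero !![0, 1; 1, 0] (by simp)
  have hlower (x : F) : σ (w * upperRightHom x * w) = 1 := by
    have hw : w * w = 1 := by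
      ext i j
      fin_cases i <;> fin_cases j <;> simp [w, mkOfDetNeZero]
    rw [map_mul, map_mul, h, mul_one, ← map_mul, hw, map_one]
  have hne : ∀ g : GL (Fin 2) F, g.val.det = 1 → g.val 1 0 ≠ 0 → σ g = 1 := by
    intro g hg hc
    rw [Matrix.det_fin_two] at hg
    have : g = upperRightHom ((g.val 0 0 - 1) / g.val 1 0) *
        (w * upperRightHom (g.val 1 0) * w) * upperRightHom ((g.val 1 1 - 1) / g.val 1 0) := by
      ext i j
      fin_cases i <;> fin_cases j <;>
        simp [w, mkOfDetNeZero, Matrix.mul_apply, Fin.sum_univ_two] <;> field_simp <;>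
        first | ring1 | linear_combination -hg
    rw [this, map_mul, map_mul, h, h, hlower, one_mul, one_mul]
  by_cases hc : g.val 1 0 = 0
  · have hval : (w * upperRightHom 1 * w).val = !![1, 0; 1, 1] := by
      ext i j
      fin_cases i <;> fin_cases j <;> simp [w, mkOfDetNeZero]
    have : σ (g * (w * upperRightHom 1 * w)) = 1 := by
      apply hne
      · rw [Units.val_mul, Matrix.det_mul, hg, hval]
        simp
      · rw [Units.val_mul, hval]
        rw [Matrix.det_fin_two, hc, mul_zero, sub_zero] at hg
        simpa [Matrix.mul_apply, Fin.sum_univ_two, hc] using right_ne_zero_of_mul_eq_one hg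
    rwa [map_mul, hlower, mul_one] at this
  · exact hne g hg hc

/-- The group of invertible matrices whose determinant is a square. -/
def squareDet (F : Type*) [Field F] : Subgroup (GL (Fin 2) F) :=
  (powMonoidHom 2 : Fˣ →* Fˣ).range.comap det

instance : (squareDet F).Normal := Subgroup.normal_comap _

theorem center_le_squareDet : Subgroup.center (GL (Fin 2) F) ≤ squareDet F := by
  rw [center_eq_range_scalar]
  rintro _ ⟨a, rfl⟩
  refine ⟨a, Units.ext ?_⟩
  simp [sq]

theorem map_eq_one_of_mem_squareDet {M : Type*} [Monoid M] (σ : GL (Fin 2) F →* M)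
    (hcenter : ∀ z ∈ Subgroup.center (GL (Fin 2) F), σ z = 1)
    (h : ∀ x, σ (upperRightHom x) = 1) {g : GL (Fin 2) F} (hg : g ∈ squareDet F) : σ g = 1 := by
  obtain ⟨a, ha⟩ := hg
  have ha' : (a : F) ^ 2 = g.val.det := by simpa using congrArg Units.val ha
  have h1 : σ (scalar (Fin 2) a⁻¹ * g) = 1 := by
    apply map_eq_one_of_det_eq_one σ h
    rw [Units.val_mul, Matrix.det_mul, ← ha']
    simp
  rwa [map_mul, hcenter _ (by rw [center_eq_range_scalar]; exact ⟨_, rfl⟩), one_mul] at h1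

theorem index_squareDet [Fintype F] (hq : Odd (Fintype.card F)) : (squareDet F).index = 2 := by
  have hdet : Function.Surjective (det : GL (Fin 2) F →* Fˣ) := by
    intro a
    refine ⟨mkOfDetNeZero !![(a : F), 0; 0, 1] (by simp), Units.ext ?_⟩
    simp [mkOfDetNeZero]
  rw [squareDet, Subgroup.index_comap_of_surjective _ hdet, IsCyclic.index_powMonoidHom_range,
    Nat.card_units, Nat.card_eq_fintype_card]
  exact Nat.gcd_eq_right (by obtain ⟨k, hk⟩ := hq; exact ⟨k, by lia⟩)

end Unipotent

section NormalSubgroup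

variable {G : Type*} [Group G] {V : Type*} [AddCommGroup V] [Module ℂ V]
  (ρ : Representation ℂ G V)

theorem isIrreducible_comp_of_surjective {H : Type*} [Group H] {f : H →* G}
    [hρ : ρ.IsIrreducible] (hf : Function.Surjective f) : IsIrreducible (ρ.comp f) := by
  let e : Subrepresentation (ρ.comp f) ≃o Subrepresentation ρ :=
    { toFun U := ⟨U.toSubmodule, fun g v hv => by
        obtain ⟨h, rfl⟩ := hf g
        exact U.apply_mem_toSubmodule h hv⟩
      invFun U := ⟨U.toSubmodule, fun g _ hv => U.apply_mem_toSubmodule (f g) hv⟩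
      left_inv _ := rfl
      right_inv _ := rfl
      map_rel_iff' := Iff.rfl }
  exact e.isSimpleOrder_iff.2 hρ

theorem sum_character_eq_zero_or_trivial [Fintype G] [FiniteDimensional ℂ V]
    [hρ : ρ.IsIrreducible] (K : Subgroup G) [K.Normal] [Fintype K] :
    ∑ k : K, ρ.character k = 0 ∨ ∀ k ∈ K, ρ k = 1 := by
  have : Invertible (Nat.card K : ℂ) := invertibleOfNonzero (NeZero.ne _)
  let U : Subrepresentation ρ :=
    { toSubmodule := invariants (ρ.comp K.subtype)
      apply_mem_toSubmodule := fun g v hv k => by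
        have hk : ρ (g⁻¹ * k * g) v = v :=
          hv ⟨g⁻¹ * k * g, by simpa using ‹K.Normal›.conj_mem k k.2 g⁻¹⟩
        change ρ k (ρ g v) = ρ g v
        conv_rhs => rw [← hk]
        simp [mul_assoc] }
  rcases hρ.eq_bot_or_eq_top U with h | h
  · left
    have hU : invariants (ρ.comp K.subtype) = ⊥ := congrArg Subrepresentation.toSubmodule h
    have := card_inv_mul_sum_char_eq_finrank (ρ.comp K.subtype)
    rw [hU, finrank_bot, Nat.cast_zero] at this
    exact (mul_eq_zero.1 this).resolve_left (inv_ne_zero (NeZero.ne _))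
  · right
    have hU : invariants (ρ.comp K.subtype) = ⊤ := congrArg Subrepresentation.toSubmodule h
    intro k hk
    ext v
    have : v ∈ invariants (ρ.comp K.subtype) := hU ▸ Submodule.mem_top
    exact this ⟨k, hk⟩

end NormalSubgroup

end Representation

section Counting

open Matrix.GeneralLinearGroup

variable {F : Type*} [Field F]

theorem sq_mem_center_iff (g : GL (Fin 2) F) :
    g ^ 2 ∈ Subgroup.center (GL (Fin 2) F) ↔
      g ∈ Subgroup.center (GL (Fin 2) F) ∨ g.val.trace = 0 := by
  have hscalar (M : Matrix (Fin 2) (Fin 2) F) : M ∈ Set.range (Matrix.scalar (Fin 2)) ↔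
      M 0 1 = 0 ∧ M 1 0 = 0 ∧ M 0 0 = M 1 1 := by
    constructor
    · rintro ⟨a, rfl⟩
      simp
    · rintro ⟨h1, h2, h3⟩
      refine ⟨M 0 0, ?_⟩
      ext i j
      fin_cases i <;> fin_cases j <;> simp [h1, h2, h3]
  rw [mem_center_iff_val_mem_range_scalar, mem_center_iff_val_mem_range_scalar, hscalar, hscalar,
    Units.val_pow_eq_pow_val, sq, Matrix.trace_fin_two]
  simp only [Matrix.mul_apply, Fin.sum_univ_two]
  constructor
  · rintro ⟨h1, h2, h3⟩
    by_cases ht : g.val 0 0 + g.val 1 1 = 0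
    · exact .inr ht
    · refine .inl ⟨?_, ?_, ?_⟩ <;> apply mul_right_cancel₀ ht
      · linear_combination h1
      · linear_combination h2
      · linear_combination h3
  · rintro (⟨h1, h2, h3⟩ | h)
    · simp [h1, h2, h3]
    · refine ⟨?_, ?_, ?_⟩
      · linear_combination g.val 0 1 * h
      · linear_combination g.val 1 0 * h
      · linear_combination (g.val 0 0 - g.val 1 1) * h

variable [Fintype F]

theorem card_center_GL_two :
    Nat.card (Subgroup.center (GL (Fin 2) F)) = Fintype.card F - 1 := by
  have hinj : Function.Injective (scalar (Fin 2) : Fˣ →* GL (Fin 2) F) := by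
    intro a b h
    have := congrArg (fun g : GL (Fin 2) F => g.val 0 0) h
    exact Units.ext (by simpa using this)
  rw [center_eq_range_scalar, ← Nat.card_congr (MonoidHom.ofInjective hinj).toEquiv,
    Nat.card_units, Nat.card_eq_fintype_card]

theorem card_PGL_two_mul :
    Nat.card (GL (Fin 2) F ⧸ Subgroup.center (GL (Fin 2) F)) =
      Fintype.card F * (Fintype.card F ^ 2 - 1) := by
  have h := Subgroup.card_eq_card_quotient_mul_card_subgroup (Subgroup.center (GL (Fin 2) F))
  rw [Matrix.card_GL_field, card_center_GL_two, Fin.prod_univ_two] at h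
  have hq : 1 < Fintype.card F := Fintype.one_lt_card
  refine Nat.eq_of_mul_eq_mul_right (by lia) (h.symm.trans ?_)
  simp only [Fin.val_zero, pow_zero, Fin.val_one, pow_one]
  rw [sq, ← Nat.mul_sub_one, mul_right_comm, mul_comm]

/-- The cone `a ^ 2 + b * c = 0` is parametrized by a plane. -/
def nilpotentConeEquiv [DecidableEq F] :
    {p : F × F × F // p.1 ^ 2 + p.2.1 * p.2.2 = 0} ≃ F × F where
  toFun p := (p.1.2.1, if p.1.2.1 = 0 then p.1.2.2 else p.1.1)
  invFun p := ⟨if p.1 = 0 then (0, 0, p.2) else (p.2, p.1, -p.2 ^ 2 / p.1), by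
    split_ifs with h
    · simp
    · field_simp
      ring⟩
  left_inv := by
    rintro ⟨⟨a, b, c⟩, h⟩
    by_cases hb : b = 0
    · subst hb
      have : a = 0 := by simpa using h
      simp [this]
    · simp only [hb, if_false, Subtype.mk.injEq, Prod.mk.injEq, true_and]
      field_simp
      linear_combination -h
  right_inv := by
    rintro ⟨b, t⟩
    by_cases hb : b = 0 <;> simp [hb]

/-- Traceless invertible matrices, in coordinates. -/
def tracelessEquiv :
    {g : GL (Fin 2) F // g.val.trace = 0} ≃
      {p : F × F × F // ¬ p.1 ^ 2 + p.2.1 * p.2.2 = 0} where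
  toFun g := ⟨(g.1.val 0 0, g.1.val 0 1, g.1.val 1 0), by
    have hdet := g.1.det.ne_zero
    have htr := g.2
    rw [Matrix.trace_fin_two] at htr
    rw [Matrix.GeneralLinearGroup.val_det_apply, Matrix.det_fin_two] at hdet
    contrapose! hdet
    linear_combination g.1.val 0 0 * htr - hdet⟩
  invFun p := ⟨mkOfDetNeZero !![p.1.1, p.1.2.1; p.1.2.2, -p.1.1] (by
    have := p.2
    rw [Matrix.det_fin_two_of]
    contrapose! this
    linear_combination -this), by simp [mkOfDetNeZero, Matrix.trace_fin_two]⟩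
  left_inv := by
    rintro ⟨g, hg⟩
    rw [Matrix.trace_fin_two] at hg
    apply Subtype.ext
    ext i j
    fin_cases i <;> fin_cases j <;> simp [mkOfDetNeZero]
    linear_combination -hg
  right_inv := by
    rintro ⟨⟨a, b, c⟩, h⟩
    simp [mkOfDetNeZero]

theorem card_traceless :
    Nat.card {g : GL (Fin 2) F // g.val.trace = 0} =
      (Fintype.card F - 1) * Fintype.card F ^ 2 := by
  classical
  rw [Nat.card_congr tracelessEquiv, Nat.card_eq_fintype_card, Fintype.card_subtype_compl,
    Fintype.card_congr nilpotentConeEquiv]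
  simp only [Fintype.card_prod]
  rw [Nat.sub_mul]
  ring_nf

theorem card_involutions_PGL_two (hq : Odd (Fintype.card F)) :
    Nat.card {g : GL (Fin 2) F ⧸ Subgroup.center (GL (Fin 2) F) // g ^ 2 = 1} =
      Fintype.card F ^ 2 + 1 := by
  set Z := Subgroup.center (GL (Fin 2) F) with hZ
  have hpre : (QuotientGroup.mk ⁻¹' {x : GL (Fin 2) F ⧸ Z | x ^ 2 = 1} : Set (GL (Fin 2) F)) =
      (Z : Set (GL (Fin 2) F)) ∪ {g | g.val.trace = 0} := by
    ext g
    rw [Set.mem_preimage, Set.mem_ofPred_eq, ← QuotientGroup.mk_pow, QuotientGroup.eq_one_iff,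
      sq_mem_center_iff]
    rfl
  have h2 : (2 : F) ≠ 0 := by
    apply Ring.two_ne_zero
    rw [ne_eq, FiniteField.even_card_iff_char_two, ← Nat.even_iff, Nat.not_even_iff_odd]
    exact hq
  have hdisj : Disjoint (Z : Set (GL (Fin 2) F)) {g | g.val.trace = 0} := by
    rw [Set.disjoint_left]
    intro g hg htr
    rw [SetLike.mem_coe, hZ, center_eq_range_scalar] at hg
    obtain ⟨a, rfl⟩ := hg
    have : (2 : F) * a = 0 := by simpa [Matrix.trace_fin_two, ← two_mul] using htr
    exact mul_ne_zero h2 a.ne_zero this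
  have hcard := QuotientGroup.card_preimage_mk Z {x | x ^ 2 = 1}
  rw [hpre, Nat.card_coe_set_eq, Set.ncard_union_eq hdisj (Set.toFinite _) (Set.toFinite _),
    ← Nat.card_coe_set_eq, ← Nat.card_coe_set_eq] at hcard
  change Nat.card Z + Nat.card {g : GL (Fin 2) F // g.val.trace = 0} = _ at hcard
  rw [card_traceless, card_center_GL_two] at hcard
  have hq1 : 1 < Fintype.card F := Fintype.one_lt_card
  refine Nat.eq_of_mul_eq_mul_left (show 0 < Fintype.card F - 1 by lia) (hcard.symm.trans ?_)
  ring

end Counting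

namespace Representation

open Matrix.GeneralLinearGroup

variable {F : Type*} [Field F]

/-- The image of `squareDet` in `PGL₂`, namely `PSL₂`. -/
def squareDetPGL (F : Type*) [Field F] : Subgroup (GL (Fin 2) F ⧸ Subgroup.center (GL (Fin 2) F)) :=
  (squareDet F).map (QuotientGroup.mk' _)

instance : (squareDetPGL F).Normal :=
  Subgroup.Normal.map inferInstance _ (QuotientGroup.mk'_surjective _)

theorem mk_upperRightHom_eq_one_iff (x : F) :
    (QuotientGroup.mk (upperRightHom x) : GL (Fin 2) F ⧸ Subgroup.center (GL (Fin 2) F)) = 1 ↔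
      x = 0 := by
  rw [QuotientGroup.eq_one_iff]
  constructor
  · rw [mem_center_iff_val_mem_range_scalar]
    rintro ⟨a, ha⟩
    simpa using (congrArg (fun M => M 0 1) ha).symm
  · rintro rfl
    rw [AddChar.map_zero_eq_one]
    exact one_mem _

variable [Fintype F]

theorem card_PGL_eq_two_mul_card_squareDetPGL (hq : Odd (Fintype.card F)) :
    Nat.card (GL (Fin 2) F ⧸ Subgroup.center (GL (Fin 2) F)) = 2 * Nat.card (squareDetPGL F) := by
  rw [← (squareDetPGL F).card_mul_index, squareDetPGL,
    Subgroup.index_map_eq _ (QuotientGroup.mk'_surjective _)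
      ((QuotientGroup.ker_mk' _).trans_le center_le_squareDet), index_squareDet hq, mul_comm]

variable {V : Type*} [AddCommGroup V] [Module ℂ V]

theorem trace_whittakerProj (σ : Representation ℂ (GL (Fin 2) F) V) (ψ : AddChar F ℂ) :
    LinearMap.trace ℂ V (whittakerProj σ ψ) =
      (Fintype.card F : ℂ)⁻¹ * ∑ x, ψ (-x) * σ.character (upperRightHom x) := by
  simp only [whittakerProj, map_smul, map_sum, smul_eq_mul, character]

variable [FiniteDimensional ℂ V]

theorem whittaker_dichotomy
    (ρ : Representation ℂ (GL (Fin 2) F ⧸ Subgroup.center (GL (Fin 2) F)) V) [ρ.IsIrreducible]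
    {ψ : AddChar F ℂ} (hψ : ψ.IsPrimitive) [Fintype (squareDetPGL F)] :
    (LinearMap.trace ℂ V (whittakerProj (ρ.comp (QuotientGroup.mk' _)) ψ) = 0 ∧
      ∑ k : squareDetPGL F, ρ.character k = Nat.card (squareDetPGL F) * Module.finrank ℂ V) ∨
    (LinearMap.trace ℂ V (whittakerProj (ρ.comp (QuotientGroup.mk' _)) ψ) = 1 ∧
      ∑ k : squareDetPGL F, ρ.character k = 0) := by
  have : Fintype (GL (Fin 2) F ⧸ Subgroup.center (GL (Fin 2) F)) := Fintype.ofFinite _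
  set σ : Representation ℂ (GL (Fin 2) F) V := ρ.comp (QuotientGroup.mk' _) with hσ
  have hirr : σ.IsIrreducible :=
    isIrreducible_comp_of_surjective ρ (QuotientGroup.mk'_surjective _)
  have hidem := whittakerProj_isIdempotentElem σ ψ
  have htrace : LinearMap.trace ℂ V (whittakerProj σ ψ) =
      Module.finrank ℂ (LinearMap.range (whittakerProj σ ψ)) :=
    (LinearMap.IsIdempotentElem.isProj_range _ hidem).trace
  by_cases htriv : ∀ k ∈ squareDetPGL F, ρ k = 1
  · left
    constructor
    · have hu (x : F) : σ (upperRightHom x) = 1 :=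
        htriv _ ⟨_, ⟨1, by ext; simp⟩, rfl⟩
      have hψ1 : ψ ≠ 1 := by simpa using hψ (one_ne_zero (α := F))
      have hsum : ∑ x, ψ (-x) = 0 :=
        (Equiv.sum_comp (Equiv.neg F) ψ).trans (AddChar.sum_eq_zero_of_ne_one hψ1)
      simp_rw [trace_whittakerProj, character, hu, ← Finset.sum_mul]
      rw [hsum, zero_mul, mul_zero]
    · simp [character, htriv]
  · right
    refine ⟨?_, (sum_character_eq_zero_or_trivial ρ _).resolve_right htriv⟩
    have hle := finrank_range_whittakerProj_le_one σ ψ hψ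
    have hne : Module.finrank ℂ (LinearMap.range (whittakerProj σ ψ)) ≠ 0 := by
      intro h0
      rw [Submodule.finrank_eq_zero, LinearMap.range_eq_bot] at h0
      apply htriv
      rintro _ ⟨g, hg, rfl⟩
      refine map_eq_one_of_mem_squareDet σ (fun z hz => ?_)
        (upperRightHom_eq_one_of_whittakerProj_eq_zero σ ψ hψ h0) hg
      rw [hσ, MonoidHom.comp_apply, QuotientGroup.mk'_apply, (QuotientGroup.eq_one_iff z).2 hz,
        map_one]
    rw [htrace, show Module.finrank ℂ (LinearMap.range (whittakerProj σ ψ)) = 1 by lia,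
      Nat.cast_one]

end Representation

/-- For `q` odd, the degree of the Gelfand model of `G = PGL₂(𝔽_q)`, i.e. the sum of the
degrees of all the irreducible complex characters of `G` (each taken once), equals the
number of involutions in `G` (elements `g` with `g² = 1`, including the identity).
Here `PGL₂(𝔽_q)` is realized as `GL₂(F) ⧸ center` for `F` a finite field of odd
cardinality. -/
theorem sum_irred_degrees_eq_card_involutions_PGL2
    (F : Type) [Field F] [Fintype F] (hq : Odd (Fintype.card F))
    (ι : Type) [Fintype ι]
    (V : ι → FDRep ℂ
      (GL (Fin 2) F ⧸ Subgroup.center (GL (Fin 2) F)))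
    (hsimple : ∀ i, Simple (V i))
    (hcomplete : ∀ W : FDRep ℂ
        (GL (Fin 2) F ⧸ Subgroup.center (GL (Fin 2) F)),
      Simple W → ∃! i, Nonempty (V i ≅ W)) :
    ∑ i, (V i).character 1 =
      (Nat.card {g : GL (Fin 2) F ⧸ Subgroup.center (GL (Fin 2) F) // g ^ 2 = 1} : ℂ) := by
  classical
  have : Fintype (GL (Fin 2) F ⧸ Subgroup.center (GL (Fin 2) F)) := Fintype.ofFinite _
  have : Fintype (Representation.squareDetPGL F) := Fintype.ofFinite _
  have hirr (i : ι) : Representation.IsIrreducible (V i).ρ :=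
    have := hsimple i
    FDRep.isIrreducible_of_simple (V i)
  let ψ := AddChar.FiniteField.primitiveChar_to_Complex F
  have hψ : ψ.IsPrimitive := AddChar.FiniteField.primitiveChar_to_Complex_isPrimitive F
  let d (i : ι) : ℕ := Module.finrank ℂ (V i)
  let m (i : ι) : ℂ :=
    LinearMap.trace ℂ (V i) (Representation.whittakerProj ((V i).ρ.comp (QuotientGroup.mk' _)) ψ)
  let s (i : ι) : ℂ := ∑ k : Representation.squareDetPGL F, (V i).character k
  let K := Nat.card (Representation.squareDetPGL F)
  have hdich (i : ι) : (m i = 0 ∧ s i = K * d i) ∨ (m i = 1 ∧ s i = 0) :=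
    Representation.whittaker_dichotomy (V i).ρ hψ
  have hcard := card_PGL_two_mul (F := F)
  have hcardK := Representation.card_PGL_eq_two_mul_card_squareDetPGL hq
  have hK : (K : ℂ) ≠ 0 := NeZero.ne _
  have hF : (Fintype.card F : ℂ) ≠ 0 := Nat.cast_ne_zero.2 Fintype.card_ne_zero
  have hreg := FDRep.sum_finrank_mul_character V hsimple hcomplete
  have hgeneric : ∑ i, (d i : ℂ) * m i = (Fintype.card F ^ 2 - 1 : ℕ) := by
    have hm (i : ι) : m i = (Fintype.card F : ℂ)⁻¹ * ∑ x : F, ψ (-x) *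
        (V i).character (QuotientGroup.mk (Matrix.GeneralLinearGroup.upperRightHom x)) :=
      Representation.trace_whittakerProj _ ψ
    calc ∑ i, (d i : ℂ) * m i
        = (Fintype.card F : ℂ)⁻¹ * ∑ x : F, ψ (-x) * ∑ i, (d i : ℂ) *
          (V i).character (QuotientGroup.mk (Matrix.GeneralLinearGroup.upperRightHom x)) := by
          simp_rw [hm, Finset.mul_sum]
          rw [Finset.sum_comm]
          refine Finset.sum_congr rfl fun x _ => Finset.sum_congr rfl fun i _ => ?_
          ring
      _ = _ := by
          simp_rw [d, hreg, Representation.mk_upperRightHom_eq_one_iff, hcard]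
          simp only [mul_ite, mul_zero, Finset.sum_ite_eq', Finset.mem_univ, if_true, neg_zero,
            AddChar.map_zero_eq_one, one_mul, Nat.cast_mul]
          rw [inv_mul_cancel_left₀ hF]
  have hdegenerate : ∑ i, (d i : ℂ) * s i = 2 * K := by
    simp_rw [s, Finset.mul_sum]
    rw [Finset.sum_comm, Finset.sum_eq_single 1]
    · exact (hreg 1).trans (by rw [if_pos rfl, hcardK, Nat.cast_mul, Nat.cast_ofNat])
    · exact fun k _ hk => (hreg k).trans (if_neg fun h => hk (Subtype.ext h))
    · simp
  have hsq : ∑ i with m i = 0, d i ^ 2 = 2 := by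
    have : (K : ℂ) * ∑ i with m i = 0, (d i : ℂ) ^ 2 = K * 2 := by
      rw [mul_comm _ 2, ← hdegenerate, Finset.mul_sum, Finset.sum_filter]
      refine Finset.sum_congr rfl fun i _ => ?_
      rcases hdich i with ⟨h0, h⟩ | ⟨h1, h⟩
      · rw [if_pos h0, h]
        ring
      · rw [if_neg (h1 ▸ one_ne_zero), h, mul_zero]
    exact_mod_cast mul_left_cancel₀ hK this
  have hlin : ∑ i with m i = 0, d i = 2 := by
    rw [← hsq]
    refine Finset.sum_congr rfl fun i hi => ?_
    have : d i ^ 2 ≤ 2 :=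
      (Finset.single_le_sum (f := fun i => d i ^ 2) (by simp) hi).trans_eq hsq
    have : d i < 2 := by nlinarith
    interval_cases d i <;> rfl
  have hsplit : ∑ i, (d i : ℂ) = ∑ i with m i = 0, (d i : ℂ) + ∑ i, (d i : ℂ) * m i := by
    rw [Finset.sum_filter, ← Finset.sum_add_distrib]
    refine Finset.sum_congr rfl fun i _ => ?_
    rcases hdich i with ⟨h0, -⟩ | ⟨h1, -⟩
    · simp [h0]
    · simp [h1]
  simp_rw [FDRep.char_one]
  rw [card_involutions_PGL_two hq]
  refine hsplit.trans ?_
  rw [hgeneric, ← Nat.cast_sum, hlin, ← Nat.cast_add]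
  have : 0 < Fintype.card F ^ 2 := pow_pos Fintype.card_pos 2
  congr 1
  lia
end

section
/- The Gelfand character of SL₂(𝔽₅) (the sum of its nine irreducible characters) is not an integer linear combination of permutation characters of SL₂(𝔽₅). -/
open CategoryTheory

/-- The permutation character of a finite group `G` acting on `G ⧸ H`. -/
noncomputable def permChar (G : Type) [Group G] (H : Subgroup G) (g : G) : ℂ :=
  (Nat.card {c : G ⧸ H // g • c = c} : ℂ)

/-- The ring `ℤ[φ][ζ]`, with `φ² = 1 + φ` the golden ratio and `ζ² = -1 + (φ - 1) ζ` a primitive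
fifth root of unity. -/
abbrev CycInt : Type := QuadraticAlgebra (QuadraticAlgebra ℤ 1 1) (-1) ⟨-1, 1⟩

namespace CycInt

/-- The power `ζ ^ k` of the primitive fifth root of unity. -/
def zetaPow : ZMod 5 → CycInt :=
  ![1, ⟨0, 1⟩, ⟨-1, ⟨-1, 1⟩⟩, ⟨⟨1, -1⟩, ⟨1, -1⟩⟩, ⟨⟨-1, 1⟩, -1⟩]

/-- The square root `2 φ - 1` of `5`. -/
def sqrtFive : CycInt := ⟨⟨-1, 2⟩, 0⟩

theorem exists_ringHom_complex : Nonempty (CycInt →+* ℂ) := by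
  have key (b c : ℂ) : ∃ u : ℂ, u * u = c + b * u := by
    obtain ⟨s, hs⟩ := IsAlgClosed.exists_pow_nat_eq (b ^ 2 + 4 * c) (n := 2) two_pos
    exact ⟨(b + s) / 2, by linear_combination hs / 4⟩
  obtain ⟨u, hu⟩ := key 1 1
  let f : QuadraticAlgebra ℤ 1 1 →ₐ[ℤ] ℂ :=
    QuadraticAlgebra.lift ⟨u, by rw [hu]; simp⟩
  let : Algebra (QuadraticAlgebra ℤ 1 1) ℂ := f.toRingHom.toAlgebra
  obtain ⟨v, hv⟩ := key (algebraMap (QuadraticAlgebra ℤ 1 1) ℂ ⟨-1, 1⟩) (-1)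
  exact ⟨(QuadraticAlgebra.lift (R := QuadraticAlgebra ℤ 1 1) (A := ℂ)
    ⟨v, by rw [hv, Algebra.smul_def, Algebra.smul_def]; simp⟩).toRingHom⟩

theorem map_sqrtFive_mul_self (f : CycInt →+* ℂ) : f sqrtFive * f sqrtFive = 5 := by
  rw [← map_mul, show sqrtFive * sqrtFive = 5 by decide +kernel, map_ofNat]

theorem map_sqrtFive_ne_zero (f : CycInt →+* ℂ) : f sqrtFive ≠ 0 := by
  intro h
  simpa [h] using map_sqrtFive_mul_self f

end CycInt

namespace WeilRep

open CycInt Matrix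

/-- Multiplication by the quadratic character of `ZMod 5` at a unit `c`. -/
def quadSign (c : ZMod 5) (z : CycInt) : CycInt := if c ^ 2 = 1 then z else -z

/-- The `(x, y)` entry of `√5` times the Weil representation of `!![a, b; c, d]` on odd functions
on `ZMod 5`. -/
def entry (a b c d x y : ZMod 5) : CycInt :=
  if c = 0 then
    if a * x = y then quadSign a (sqrtFive * zetaPow (y ^ 2 * b * d))
    else if a * x = -y then -quadSign a (sqrtFive * zetaPow (y ^ 2 * b * d))
    else 0
  else
    quadSign c (zetaPow ((a * x ^ 2 + d * y ^ 2 - 2 * x * y) * c ^ 3) -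
      zetaPow ((a * x ^ 2 + d * y ^ 2 + 2 * x * y) * c ^ 3))

/-- `√5` times the odd part of the Weil representation of `SL₂(𝔽₅)`. -/
def scaled (g : SpecialLinearGroup (Fin 2) (ZMod 5)) : Matrix (Fin 2) (Fin 2) CycInt :=
  let e := entry (g 0 0) (g 0 1) (g 1 0) (g 1 1)
  !![e 1 1, e 1 2; e 2 1, e 2 2]

/-- The translation generator of `SL₂(𝔽₅)`. -/
def genT : SpecialLinearGroup (Fin 2) (ZMod 5) := ⟨!![1, 1; 0, 1], by decide⟩

/-- The Weyl generator of `SL₂(𝔽₅)`. -/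
def genS : SpecialLinearGroup (Fin 2) (ZMod 5) := ⟨!![0, -1; 1, 0], by decide⟩

set_option maxRecDepth 100000 in
theorem eq_word_of_ne_zero : ∀ g : SpecialLinearGroup (Fin 2) (ZMod 5), g 1 0 ≠ 0 →
    g = genT ^ ((g 0 0 - 1) * g 1 0 ^ 3).val * genS * genT ^ (-g 1 0).val * genS ^ 3 *
      genT ^ ((g 1 1 - 1) * g 1 0 ^ 3).val := by
  decide +kernel

theorem closure_generators : Submonoid.closure {genT, genS} = ⊤ := by
  have hT : genT ∈ Submonoid.closure {genT, genS} := Submonoid.subset_closure (by simp)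
  have hS : genS ∈ Submonoid.closure {genT, genS} := Submonoid.subset_closure (by simp)
  have big (g : SpecialLinearGroup (Fin 2) (ZMod 5)) (hg : g 1 0 ≠ 0) :
      g ∈ Submonoid.closure {genT, genS} := by
    rw [eq_word_of_ne_zero g hg]
    exact mul_mem (mul_mem (mul_mem (mul_mem (pow_mem hT _) hS) (pow_mem hT _)) (pow_mem hS _))
      (pow_mem hT _)
  refine top_unique fun g _ ↦ ?_
  by_cases hg : g 1 0 = 0
  · have hS4 : genS ^ 3 * genS = 1 := by decide +kernel
    rw [show g = genS ^ 3 * (genS * g) by rw [← mul_assoc, hS4, one_mul]]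
    refine mul_mem (pow_mem hS _) (big _ fun h ↦ ?_)
    have h0 : g 0 0 = 0 := by
      change (genS.1 * g.1) 1 0 = 0 at h
      simpa [genS, Matrix.mul_apply, Fin.sum_univ_two] using h
    have hdet := g.det_coe
    rw [Matrix.det_fin_two, h0, hg] at hdet
    exact absurd hdet (by rw [zero_mul, mul_zero, sub_zero]; decide)
  · exact big g hg

set_option maxRecDepth 100000 in
theorem scaled_genT_mul : ∀ g, sqrtFive • scaled (genT * g) = scaled genT * scaled g := by
  decide +kernel

set_option maxRecDepth 100000 in
theorem scaled_genS_mul : ∀ g, sqrtFive • scaled (genS * g) = scaled genS * scaled g := by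
  decide +kernel

set_option maxRecDepth 100000 in
theorem scaled_one : scaled 1 = sqrtFive • 1 := by
  decide +kernel

set_option maxRecDepth 100000 in
theorem det_scaled_sub : ∀ g, g ≠ 1 →
    let x := (scaled g - sqrtFive • 1).det
    x = 5 ∨ x = 10 ∨ x = 15 ∨ x = 20 ∨ x ^ 2 - 15 * x + 25 = 0 ∨ x ^ 2 - 25 * x + 125 = 0 := by
  decide +kernel

set_option maxRecDepth 100000 in
theorem sum_trace_scaled :
    ∑ g, (scaled g).trace * (scaled g⁻¹).trace = 600 := by
  decide +kernel

set_option maxRecDepth 100000 in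
theorem card_SL2_F5 : Nat.card (SpecialLinearGroup (Fin 2) (ZMod 5)) = 120 := by
  rw [Nat.card_eq_fintype_card]
  decide +kernel

/-- The odd part of the Weil representation of `SL₂(𝔽₅)`, a two-dimensional complex
representation. -/
noncomputable def matrixRep (f : CycInt →+* ℂ) :
    SpecialLinearGroup (Fin 2) (ZMod 5) →* Matrix (Fin 2) (Fin 2) ℂ where
  toFun g := (f sqrtFive)⁻¹ • (scaled g).map f
  map_one' := by
    rw [scaled_one, Matrix.map_smul' _ _ _ (map_mul f), Matrix.map_one _ (map_zero f) (map_one f),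
      inv_smul_smul₀ (map_sqrtFive_ne_zero f)]
  map_mul' g h := by
    have hs := map_sqrtFive_ne_zero f
    have step (u v : SpecialLinearGroup (Fin 2) (ZMod 5))
        (huv : sqrtFive • scaled (u * v) = scaled u * scaled v) :
        (f sqrtFive)⁻¹ • (scaled (u * v)).map f =
          ((f sqrtFive)⁻¹ • (scaled u).map f) * ((f sqrtFive)⁻¹ • (scaled v).map f) := by
      have h1 := congrArg (fun M ↦ M.map f) huv
      simp only [Matrix.map_smul' _ _ _ (map_mul f), Matrix.map_mul] at h1
      rw [Matrix.smul_mul, Matrix.mul_smul, ← h1, inv_smul_smul₀ hs]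
    have hg : g ∈ Submonoid.closure {genT, genS} := closure_generators ▸ Submonoid.mem_top g
    induction hg using Submonoid.closure_induction generalizing h with
    | mem x hx =>
      rcases hx with rfl | rfl
      · exact step _ _ (scaled_genT_mul h)
      · exact step _ _ (scaled_genS_mul h)
    | one =>
      rw [one_mul, scaled_one, Matrix.map_smul' _ _ _ (map_mul f),
        Matrix.map_one _ (map_zero f) (map_one f), inv_smul_smul₀ hs, one_mul]
    | mul x y _ _ hx hy => rw [mul_assoc, hx, hy, hx, mul_assoc]

theorem matrixRep_apply (f : CycInt →+* ℂ) (g : SpecialLinearGroup (Fin 2) (ZMod 5)) :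
    matrixRep f g = (f sqrtFive)⁻¹ • (scaled g).map f := rfl

theorem det_matrixRep_sub_one_ne_zero (f : CycInt →+* ℂ)
    {g : SpecialLinearGroup (Fin 2) (ZMod 5)} (hg : g ≠ 1) : (matrixRep f g - 1).det ≠ 0 := by
  have hs := map_sqrtFive_ne_zero f
  have hx : f (scaled g - sqrtFive • 1).det = f sqrtFive ^ 2 * (matrixRep f g - 1).det := by
    have : f.mapMatrix (scaled g - sqrtFive • 1) = f sqrtFive • (matrixRep f g - 1) := by
      rw [map_sub, smul_sub, matrixRep_apply, smul_inv_smul₀ hs, RingHom.mapMatrix_apply,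
        RingHom.mapMatrix_apply, Matrix.map_smul' _ _ _ (map_mul f),
        Matrix.map_one _ (map_zero f) (map_one f)]
    rw [RingHom.map_det, this, Matrix.det_smul, Fintype.card_fin]
  intro h0
  rw [h0, mul_zero] at hx
  have h := det_scaled_sub g hg
  set x := (scaled g - sqrtFive • 1).det
  have hn (n : ℕ) [n.AtLeastTwo] : f ofNat(n) = ofNat(n) := map_ofNat f n
  rcases h with h | h | h | h | h | h <;> simpa [hx, hn] using congrArg f h

theorem sum_trace_matrixRep (f : CycInt →+* ℂ) :
    ∑ g, (matrixRep f g).trace * (matrixRep f g⁻¹).trace = 120 := by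
  have htr (g) : (matrixRep f g).trace = (f sqrtFive)⁻¹ * f (scaled g).trace := by
    rw [matrixRep_apply, Matrix.trace_smul, smul_eq_mul, AddMonoidHom.map_trace f]
  have h := congrArg f sum_trace_scaled
  rw [map_sum, map_ofNat] at h
  simp_rw [map_mul] at h
  have hmul (g) : (matrixRep f g).trace * (matrixRep f g⁻¹).trace =
      5⁻¹ * (f (scaled g).trace * f (scaled g⁻¹).trace) := by
    rw [htr, htr, ← map_sqrtFive_mul_self f, mul_inv]
    ring
  simp_rw [hmul, ← Finset.mul_sum, h]
  norm_num

/-- The odd part of the Weil representation of `SL₂(𝔽₅)` as an object of `FDRep`. -/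
noncomputable def fdRep (f : CycInt →+* ℂ) :
    FDRep ℂ (SpecialLinearGroup (Fin 2) (ZMod 5)) :=
  FDRep.of (V := Fin 2 → ℂ)
    ((Matrix.toLinAlgEquiv' : _ ≃ₐ[ℂ] _).toMonoidHom.comp (matrixRep f))

theorem character_fdRep (f : CycInt →+* ℂ) (g : SpecialLinearGroup (Fin 2) (ZMod 5)) :
    (fdRep f).character g = (matrixRep f g).trace :=
  Matrix.trace_toLin'_eq _

theorem simple_fdRep (f : CycInt →+* ℂ) : Simple (fdRep f) := by
  rw [FDRep.simple_iff_char_is_norm_one, card_SL2_F5]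
  simp_rw [character_fdRep, sum_trace_matrixRep]
  norm_num

end WeilRep

section FixedPoints

variable {G : Type} [Group G] [Fintype G]

open scoped Classical in
theorem sum_permChar_mul (H : Subgroup G) (χ : G → ℂ) :
    ∑ g, permChar G H g * χ g = ∑ c : G ⧸ H, ∑ g : G, if g • c = c then χ g else 0 := by
  rw [Finset.sum_comm]
  refine Finset.sum_congr rfl fun g _ ↦ ?_
  rw [permChar, Nat.card_eq_fintype_card, Fintype.card_subtype, ← Finset.sum_filter,
    Finset.sum_const, nsmul_eq_mul]

theorem sum_stabilizer_eq_zero {n X : Type} [Fintype n] [DecidableEq n] [DecidableEq X]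
    [MulAction G X] (ρ : G →* Matrix n n ℂ) {c : X} {h : G} (hc : h • c = c) (hdet : (ρ h - 1).det ≠ 0) :
    (∑ g : G, if g • c = c then ρ g⁻¹ else 0) = 0 := by
  set P := ∑ g : G, if g • c = c then ρ g⁻¹ else 0 with hP
  have hfix : ρ h * P = P := by
    rw [hP, Finset.mul_sum, ← Equiv.sum_comp (Equiv.mulRight h)]
    refine Finset.sum_congr rfl fun g _ ↦ ?_
    simp only [Equiv.coe_mulRight, mul_smul, hc, mul_ite, mul_zero, ← map_mul, mul_inv_rev,
      mul_inv_cancel_left]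
  have hker : (ρ h - 1) * P = 0 := by rw [sub_mul, hfix, one_mul, sub_self]
  have hu : IsUnit (ρ h - 1) := (Matrix.isUnit_iff_isUnit_det _).2 hdet.isUnit
  exact hu.mul_right_eq_zero.1 hker

open scoped Classical in
/-- If no nontrivial element of `G` has eigenvalue `1` on a two-dimensional representation, then
this representation occurs with even multiplicity in every permutation character. -/
theorem exists_sum_permChar_mul_trace (ρ : G →* Matrix (Fin 2) (Fin 2) ℂ)
    (hρ : ∀ g, g ≠ 1 → (ρ g - 1).det ≠ 0) (H : Subgroup G) :
    ∃ k : ℤ, ∑ g, permChar G H g * (ρ g⁻¹).trace = 2 * k * Nat.card G := by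
  have htr (c : G ⧸ H) : (∑ g : G, if g • c = c then (ρ g⁻¹).trace else 0) =
      (∑ g : G, if g • c = c then ρ g⁻¹ else 0).trace := by
    rw [Matrix.trace_sum]
    exact Finset.sum_congr rfl fun g _ ↦ by split_ifs <;> simp
  simp_rw [sum_permChar_mul H fun g ↦ (ρ g⁻¹).trace, htr]
  rcases H.bot_or_exists_ne_one with rfl | ⟨h, hH, hne⟩
  · refine ⟨1, ?_⟩
    have hstab (c : G ⧸ (⊥ : Subgroup G)) (g : G) : g • c = c ↔ g = 1 := by
      induction c using QuotientGroup.induction_on with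
      | H x =>
        rw [MulAction.Quotient.smul_coe, eq_comm, QuotientGroup.eq, Subgroup.mem_bot,
          smul_eq_mul, inv_mul_eq_one, eq_comm, mul_eq_right]
    have hcard : Nat.card (G ⧸ (⊥ : Subgroup G)) = Nat.card G := Subgroup.index_bot
    rw [Nat.card_eq_fintype_card] at hcard
    simp [hstab, hcard, mul_comm]
  · refine ⟨0, ?_⟩
    have hzero (c : G ⧸ H) : (∑ g : G, if g • c = c then ρ g⁻¹ else 0) = 0 := by
      induction c using QuotientGroup.induction_on with
      | H x =>
        refine sum_stabilizer_eq_zero ρ (c := (x : G ⧸ H)) (h := x * h * x⁻¹) ?_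
          (hρ _ (conj_eq_one_iff.not.2 hne))
        rw [MulAction.Quotient.smul_coe, eq_comm, QuotientGroup.eq]
        simpa using hH
    simp [hzero]

end FixedPoints

/-- The Gelfand character of `SL₂(𝔽₅)` (the sum of its nine irreducible complex
characters) is not an integer linear combination of permutation characters of
`SL₂(𝔽₅)`. -/
theorem SL2_F5_gelfand_not_integer_combination_of_perm_chars
    (ι : Type) [Fintype ι]
    (V : ι → FDRep ℂ (Matrix.SpecialLinearGroup (Fin 2) (ZMod 5)))
    (hsimple : ∀ i, Simple (V i))
    (hcomplete : ∀ W : FDRep ℂ (Matrix.SpecialLinearGroup (Fin 2) (ZMod 5)),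
      Simple W → ∃! i, Nonempty (V i ≅ W)) :
    ¬ ∃ (s : Finset (Subgroup (Matrix.SpecialLinearGroup (Fin 2) (ZMod 5))))
        (a : Subgroup (Matrix.SpecialLinearGroup (Fin 2) (ZMod 5)) → ℤ),
      ∀ g : Matrix.SpecialLinearGroup (Fin 2) (ZMod 5),
        ∑ i, (V i).character g =
          ∑ H ∈ s, (a H : ℂ) * permChar (Matrix.SpecialLinearGroup (Fin 2) (ZMod 5)) H g := by
  classical
  rintro ⟨s, a, hsa⟩
  obtain ⟨f⟩ := CycInt.exists_ringHom_complex
  have hW := WeilRep.simple_fdRep f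
  obtain ⟨i₀, hi₀, huniq⟩ := hcomplete _ hW
  have hcard : (Nat.card (Matrix.SpecialLinearGroup (Fin 2) (ZMod 5)) : ℂ) ≠ 0 :=
    Nat.cast_ne_zero.2 Nat.card_pos.ne'
  have := invertibleOfNonzero hcard
  have horth (i : ι) : ∑ g, (V i).character g * (WeilRep.matrixRep f g⁻¹).trace =
      if i = i₀ then (Nat.card (Matrix.SpecialLinearGroup (Fin 2) (ZMod 5)) : ℂ) else 0 := by
    have := hsimple i
    have h := FDRep.char_orthonormal (V i) (WeilRep.fdRep f)
    have hiff : Nonempty (V i ≅ WeilRep.fdRep f) ↔ i = i₀ :=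
      ⟨huniq i, fun h ↦ h ▸ hi₀⟩
    simp_rw [WeilRep.character_fdRep, hiff] at h
    rw [inv_mul_eq_iff_eq_mul₀ hcard] at h
    simpa using h
  choose k hk using exists_sum_permChar_mul_trace (WeilRep.matrixRep f)
    fun g ↦ WeilRep.det_matrixRep_sub_one_ne_zero f
  have hgelfand : ∑ g, (∑ i, (V i).character g) * (WeilRep.matrixRep f g⁻¹).trace =
      Nat.card (Matrix.SpecialLinearGroup (Fin 2) (ZMod 5)) := by
    simp_rw [Finset.sum_mul]
    rw [Finset.sum_comm]
    simp [horth]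
  simp_rw [hsa, Finset.sum_mul, mul_assoc] at hgelfand
  rw [Finset.sum_comm] at hgelfand
  simp_rw [← Finset.mul_sum, hk, ← mul_assoc, ← Finset.sum_mul] at hgelfand
  have hone : ∑ H ∈ s, (a H : ℂ) * 2 * k H = 1 :=
    mul_right_cancel₀ hcard (by rw [hgelfand, one_mul])
  have hodd : 2 * ∑ H ∈ s, a H * k H = (1 : ℤ) := by
    rw [← Int.cast_inj (α := ℂ)]
    push_cast
    rw [← hone, Finset.mul_sum]
    exact Finset.sum_congr rfl fun H _ ↦ by ring
  omega
end
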